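/- For every k ≥ 2 there exists a countably infinite family (Ω_j)_{j ∈ ℕ} of Fatou–Bieberbach domains in ℂ^k such that (i) Ω_i ∩ Ω_l = ∅ for all i ≠ l, and (ii) every point q ∈ ℂ^k \ ⋃_{j} Ω_j lies in the topological boundary (frontier) of Ω_i for every i ∈ ℕ. In particular the union ⋃_j Ω_j is dense in ℂ^k. -/

import Mathlib

open Metric Set Filter

noncomputable section

/-- A Fatou–Bieberbach domain in `ℂ^k`: an open set `Ω ≠ ℂ^k` which is the range of an
injective entire map `ℂ^k → ℂ^k`. -/
def IsFBDomain {k : ℕ} (Ω : Set (EuclideanSpace ℂ (Fin k))) : Prop :=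
  IsOpen Ω ∧ Ω ≠ Set.univ ∧
    ∃ F : EuclideanSpace ℂ (Fin k) → EuclideanSpace ℂ (Fin k),
      Differentiable ℂ F ∧ Function.Injective F ∧ Set.range F = Ω

open Topology

section Abstract

variable {E : Type*} [NormedAddCommGroup E] [NormedSpace ℂ E]

/-- Cauchy estimate for the Fréchet derivative. -/
lemma fderiv_norm_le_of_bound {f : E → E} (hf : Differentiable ℂ f) {x : E} {C : ℝ}
    (hC : ∀ z, ‖z - x‖ ≤ 1 → ‖f z‖ ≤ C) : ‖fderiv ℂ f x‖ ≤ C := by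
  have hC0 : 0 ≤ C := (norm_nonneg _).trans (hC x (by simp))
  refine ContinuousLinearMap.opNorm_le_bound _ hC0 fun v => ?_
  rcases eq_or_ne v 0 with rfl | hv
  · simp
  have hv' : 0 < ‖v‖ := norm_pos_iff.2 hv
  have hd : Differentiable ℂ (fun t : ℂ => f (x + t • v)) := by fun_prop
  have h1 : HasDerivAt (fun t : ℂ => f (x + t • v)) (fderiv ℂ f x v) 0 := by
    have h2 : HasDerivAt (fun t : ℂ => x + t • v) v 0 := by
      simpa using ((hasDerivAt_id (0 : ℂ)).smul_const v).const_add x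
    have h3 : HasFDerivAt f (fderiv ℂ f x) (x + (0 : ℂ) • v) := by
      simpa using (hf x).hasFDerivAt
    exact h3.comp_hasDerivAt (0 : ℂ) h2
  have h4 := Complex.norm_deriv_le_of_forall_mem_sphere_norm_le (f := fun t : ℂ => f (x + t • v))
    (c := 0) (R := 1 / ‖v‖) (C := C) (by positivity) hd.diffContOnCl (by
      intro t ht
      apply hC
      have : ‖t‖ = 1 / ‖v‖ := by simpa using ht
      rw [add_sub_cancel_left, norm_smul, this]
      field_simp
      exact le_rfl)
  rw [h1.deriv] at h4
  simpa using h4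

lemma lipschitz_of_near_id {f : E → E} (hf : Differentiable ℂ f) {R : ℝ}
    (hR : ∀ z, ‖z‖ ≤ R + 1 → ‖f z - z‖ ≤ 1) {x y : E} (hx : ‖x‖ ≤ R) (hy : ‖y‖ ≤ R) :
    ‖f x - f y‖ ≤ 2 * ‖x - y‖ := by
  have h1 : ‖(f x - x) - (f y - y)‖ ≤ 1 * ‖x - y‖ := by
    refine (convex_closedBall (0 : E) R).norm_image_sub_le_of_norm_fderiv_le (𝕜 := ℂ)
      (f := fun z => f z - z) (fun z _ => (hf.sub differentiable_id) z) ?_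
      (by simpa using hy) (by simpa using hx)
    intro z hz
    refine fderiv_norm_le_of_bound (hf.sub differentiable_id) ?_
    intro w hw
    apply hR
    have h2 : ‖z‖ ≤ R := by simpa using hz
    have h3 : ‖w‖ ≤ ‖w - z‖ + ‖z‖ := by simpa using norm_add_le (w - z) z
    linarith
  have h2 : f x - f y = ((f x - x) - (f y - y)) + (x - y) := by abel
  rw [h2]
  refine (norm_add_le _ _).trans ?_
  linarith

lemma differentiableAt_of_limit [CompleteSpace E] {f : ℕ → E → E}
    (hf : ∀ m, Differentiable ℂ (f m)) {g : E → E} {z : E}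
    (hb : ∀ m x, ‖x - z‖ ≤ 2 → ‖f (m + 1) x - f m x‖ ≤ (1 / 2 : ℝ) ^ m)
    (hg : ∀ x, ‖x - z‖ ≤ 2 → Tendsto (fun m => f m x) atTop (𝓝 (g x))) :
    DifferentiableAt ℂ g z := by
  have hd : ∀ m x, x ∈ ball z 1 →
      dist (fderiv ℂ (f m) x) (fderiv ℂ (f (m + 1)) x) ≤ 1 * (1 / 2 : ℝ) ^ m := by
    intro m x hx
    rw [dist_comm, dist_eq_norm, one_mul]
    have : fderiv ℂ (f (m + 1)) x - fderiv ℂ (f m) x = fderiv ℂ (fun y => f (m + 1) y - f m y) x := by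
      rw [fderiv_fun_sub (hf _ _) (hf _ _)]
    rw [this]
    refine fderiv_norm_le_of_bound ((hf _).sub (hf _)) ?_
    intro w hw
    apply hb
    have h2 : ‖x - z‖ < 1 := by simpa [dist_eq_norm] using hx
    have h3 : ‖w - z‖ ≤ ‖w - x‖ + ‖x - z‖ := by simpa using norm_add_le (w - x) (x - z)
    linarith
  have hlim : ∀ x, ∃ L, x ∈ ball z 1 → Tendsto (fun m => fderiv ℂ (f m) x) atTop (𝓝 L) := by
    intro x
    by_cases hx : x ∈ ball z 1
    · obtain ⟨L, hL⟩ := cauchySeq_tendsto_of_complete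
        (cauchySeq_of_le_geometric (1 / 2 : ℝ) 1 (by norm_num) (fun m => hd m x hx))
      exact ⟨L, fun _ => hL⟩
    · exact ⟨0, fun h => absurd h hx⟩
  choose g' hg' using hlim
  have hu : TendstoUniformlyOn (fun m x => fderiv ℂ (f m) x) g' atTop (ball z 1) := by
    rw [Metric.tendstoUniformlyOn_iff]
    intro ε hε
    have h0 : Tendsto (fun m : ℕ => 1 * (1 / 2 : ℝ) ^ m / (1 - 1 / 2)) atTop (𝓝 0) := by
      have := (tendsto_pow_atTop_nhds_zero_of_lt_one (r := (1 / 2 : ℝ)) (by norm_num)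
        (by norm_num))
      simpa using (this.const_mul 1).div_const (1 - 1 / 2)
    filter_upwards [h0.eventually (gt_mem_nhds hε)] with m hm x hx
    rw [dist_comm]
    exact (dist_le_of_le_geometric_of_tendsto (1 / 2 : ℝ) 1 (by norm_num)
      (fun m => hd m x hx) (hg' x hx) m).trans_lt hm
  exact (hasFDerivAt_of_tendstoUniformlyOn isOpen_ball hu
    (fun m x _ => (hf m x).hasFDerivAt)
    (fun x hx => hg x (by
      have h2 : ‖x - z‖ < 1 := by simpa [dist_eq_norm] using hx
      linarith)) (mem_ball_self one_pos)).differentiableAt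

/-- The abstract basin theorem. -/
theorem basin_abstract [CompleteSpace E] (R : ℕ → E ≃ E)
    (hR : ∀ m, Differentiable ℂ (R m)) (hR' : ∀ m, Differentiable ℂ (R m).symm)
    (h1 : ∀ m w, ‖w‖ ≤ 2 ^ m → ‖R m ((R (m + 1)).symm w) - w‖ ≤ (1 / 2 : ℝ) ^ m / 4)
    (h2 : ∀ m w, ‖w‖ ≤ 2 ^ m → ‖R (m + 1) ((R m).symm w) - w‖ ≤ (1 / 2 : ℝ) ^ m / 4) :
    ∃ F : E → E, Differentiable ℂ F ∧ Function.Injective F ∧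
      Set.range F = {x | ∃ m, ‖R m x‖ < 2 ^ m} := by
  -- the compositions `P n m = R n ∘ (R m)⁻¹`
  set P : ℕ → ℕ → E → E := fun n m z => R n ((R m).symm z) with hP
  have hPd : ∀ n m, Differentiable ℂ (P n m) := fun n m => (hR n).comp (hR' m)
  have hPs : ∀ n m z, P n (m + 1) z = P n m (R m ((R (m + 1)).symm z)) := by
    intro n m z; simp [hP]
  have key : ∀ n j z, ‖z‖ + ((1 / 2 : ℝ) ^ n - (1 / 2) ^ (n + j)) / 2 ≤ 2 ^ n →
      ‖P n (n + j) z - z‖ ≤ ((1 / 2 : ℝ) ^ n - (1 / 2) ^ (n + j)) / 2 := by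
    intro n j
    induction j with
    | zero => intro z _; simp [hP]
    | succ j ih =>
      intro z hz
      have e1 : (1 / 2 : ℝ) ^ (n + (j + 1)) = (1 / 2) ^ (n + j) / 2 := by
        rw [← add_assoc, pow_succ]; ring
      rw [e1] at hz ⊢
      have p1 : (0 : ℝ) < (1 / 2) ^ (n + j) := by positivity
      have p2 : (1 / 2 : ℝ) ^ (n + j) ≤ (1 / 2) ^ n :=
        pow_le_pow_of_le_one (by norm_num) (by norm_num) (by omega)
      have p3 : (2 : ℝ) ^ n ≤ 2 ^ (n + j) := pow_le_pow_right₀ (by norm_num) (by omega)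
      have hq := h1 (n + j) z (by linarith)
      rw [← add_assoc, hPs]
      set q := R (n + j) ((R (n + j + 1)).symm z)
      have hq' : ‖q‖ ≤ ‖q - z‖ + ‖z‖ := by simpa using norm_add_le (q - z) z
      have := ih q (by linarith)
      have h3 : ‖P n (n + j) q - z‖ ≤ ‖P n (n + j) q - q‖ + ‖q - z‖ := by
        simpa using norm_add_le (P n (n + j) q - q) (q - z)
      linarith
  have half1 : ∀ n : ℕ, (1 / 2 : ℝ) ^ n ≤ 1 := fun n => pow_le_one₀ (by norm_num) (by norm_num)
  have key' : ∀ n m z, n ≤ m → ‖z‖ ≤ 2 ^ n - 1 → ‖P n m z - z‖ ≤ (1 / 2 : ℝ) ^ n := by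
    intro n m z hnm hz
    obtain ⟨j, rfl⟩ := Nat.exists_eq_add_of_le hnm
    have p1 : (0 : ℝ) < (1 / 2) ^ (n + j) := by positivity
    have p2 : (0 : ℝ) < (1 / 2) ^ n := by positivity
    have p3 := half1 n
    have := key n j z (by linarith)
    linarith
  have lip : ∀ n m x y, n ≤ m → ‖x‖ ≤ 2 ^ n - 2 → ‖y‖ ≤ 2 ^ n - 2 →
      ‖P n m x - P n m y‖ ≤ 2 * ‖x - y‖ := by
    intro n m x y hnm hx hy
    refine lipschitz_of_near_id (hPd n m) (R := 2 ^ n - 2) ?_ hx hy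
    intro z hz
    exact (key' n m z hnm (by linarith)).trans (half1 n)
  have step : ∀ n m z, n ≤ m → ‖z‖ ≤ 2 ^ n - 3 →
      ‖P n (m + 1) z - P n m z‖ ≤ (1 / 2 : ℝ) ^ m := by
    intro n m z hnm hz
    have p3 : (2 : ℝ) ^ n ≤ 2 ^ m := pow_le_pow_right₀ (by norm_num) (by omega)
    have hq := h1 m z (by linarith)
    rw [hPs]
    set q := R m ((R (m + 1)).symm z)
    have hq' : ‖q‖ ≤ ‖q - z‖ + ‖z‖ := by simpa using norm_add_le (q - z) z
    have p4 := half1 m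
    have p5 : (0 : ℝ) < (1 / 2) ^ m := by positivity
    have := lip n m q z hnm (by linarith) (by linarith)
    linarith
  have big : ∀ C : ℝ, ∃ n0 : ℕ, ∀ n, n0 ≤ n → C ≤ 2 ^ n := by
    intro C
    exact (tendsto_atTop.1 (tendsto_pow_atTop_atTop_of_one_lt (r := (2 : ℝ)) (by norm_num)) C
      |> eventually_atTop.1)
  have hlim0 : ∀ n z, ‖z‖ ≤ 2 ^ n - 3 → ∃ L, Tendsto (fun m => P n m z) atTop (𝓝 L) := by
    intro n z hz
    have hc : CauchySeq (fun j => P n (j + n) z) := by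
      refine cauchySeq_of_le_geometric (1 / 2 : ℝ) 1 (by norm_num) (fun j => ?_)
      rw [dist_comm, dist_eq_norm, one_mul]
      have := step n (j + n) z (by omega) hz
      have e : j + 1 + n = j + n + 1 := by ring
      rw [e]
      exact this.trans (pow_le_pow_of_le_one (by norm_num) (by norm_num) (by omega))
    obtain ⟨L, hL⟩ := cauchySeq_tendsto_of_complete hc
    exact ⟨L, (tendsto_add_atTop_iff_nat n).1 hL⟩
  have hlim : ∀ z, ∃ L, Tendsto (fun m => (R m).symm z) atTop (𝓝 L) := by
    intro z
    obtain ⟨n, hn⟩ := big (‖z‖ + 3)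
    obtain ⟨L, hL⟩ := hlim0 n z (by linarith [hn n le_rfl])
    refine ⟨(R n).symm L, ?_⟩
    have := ((hR' n).continuous.tendsto L).comp hL
    refine this.congr fun m => ?_
    simp [hP]
  choose F hF using hlim
  have hFP : ∀ n z, Tendsto (fun m => P n m z) atTop (𝓝 (R n (F z))) := fun n z =>
    ((hR n).continuous.tendsto (F z)).comp (hF z)
  have hclose : ∀ n z, ‖z‖ ≤ 2 ^ n - 1 → ‖R n (F z) - z‖ ≤ (1 / 2 : ℝ) ^ n := by
    intro n z hz
    have ht : Tendsto (fun m => ‖P n m z - z‖) atTop (𝓝 ‖R n (F z) - z‖) :=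
      ((hFP n z).sub_const z).norm
    refine le_of_tendsto ht ?_
    filter_upwards [eventually_ge_atTop n] with m hm
    exact key' n m z hm hz
  refine ⟨F, ?_, ?_, ?_⟩
  · intro z
    obtain ⟨n, hn⟩ := big (‖z‖ + 5)
    have hn' := hn n le_rfl
    have hd : DifferentiableAt ℂ (fun x => R n (F x)) z := by
      refine differentiableAt_of_limit (f := fun j => P n (j + n)) (fun j => hPd _ _) ?_ ?_
      · intro m x hx
        have hx' : ‖x‖ ≤ ‖x - z‖ + ‖z‖ := by simpa using norm_add_le (x - z) z
        have := step n (m + n) x (by omega) (by linarith)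
        have e : m + 1 + n = m + n + 1 := by ring
        simp only [e]
        exact this.trans (pow_le_pow_of_le_one (by norm_num) (by norm_num) (by omega))
      · intro x hx
        exact (tendsto_add_atTop_iff_nat (f := fun m => P n m x) n).2 (hFP n x)
    have := (hR' n (R n (F z))).comp z hd
    have e : (⇑(R n).symm ∘ fun x => (R n) (F x)) = F := by ext x; simp
    rwa [e] at this
  · intro z z' hzz
    have hb : ∀ᶠ n : ℕ in atTop, ‖z - z'‖ ≤ 2 * (1 / 2 : ℝ) ^ n := by
      obtain ⟨n, hn⟩ := big (‖z‖ + 1)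
      obtain ⟨n', hn'⟩ := big (‖z'‖ + 1)
      filter_upwards [eventually_ge_atTop n, eventually_ge_atTop n'] with m hm hm'
      have a1 := hclose m z (by linarith [hn m hm])
      have a2 := hclose m z' (by linarith [hn' m hm'])
      rw [← hzz] at a2
      have : z - z' = (R m (F z) - z') - (R m (F z) - z) := by abel
      rw [this]
      refine (norm_sub_le _ _).trans ?_
      linarith
    have h0 : Tendsto (fun m : ℕ => 2 * (1 / 2 : ℝ) ^ m) atTop (𝓝 0) := by
      have := (tendsto_pow_atTop_nhds_zero_of_lt_one (r := (1 / 2 : ℝ)) (by norm_num)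
        (by norm_num))
      simpa using this.const_mul 2
    have := ge_of_tendsto h0 hb
    exact sub_eq_zero.1 (norm_le_zero_iff.1 this)
  · ext x
    constructor
    · rintro ⟨z, rfl⟩
      obtain ⟨n, hn⟩ := big (‖z‖ + 2)
      have hn' := hn n le_rfl
      refine ⟨n, ?_⟩
      have a1 := hclose n z (by linarith)
      have a2 : ‖R n (F z)‖ ≤ ‖R n (F z) - z‖ + ‖z‖ := by
        simpa using norm_add_le (R n (F z) - z) z
      have a3 := half1 n
      linarith
    · rintro ⟨n, hn⟩
      -- forward orbit converges
      have fb : ∀ j, ‖R (n + j) x‖ + (1 / 2 : ℝ) ^ (n + j) ≤ 2 ^ n + 1 ∧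
          ‖R (n + j) x‖ ≤ 2 ^ (n + j) := by
        intro j
        induction j with
        | zero => exact ⟨by linarith [half1 (n + 0), hn.le, show ‖R (n + 0) x‖ = ‖R n x‖ from rfl],
            hn.le⟩
        | succ j ih =>
          have a := h2 (n + j) (R (n + j) x) ih.2
          simp only [Equiv.symm_apply_apply] at a
          have b : ‖R (n + j + 1) x‖ ≤ ‖R (n + j + 1) x - R (n + j) x‖ + ‖R (n + j) x‖ := by
            simpa using norm_add_le (R (n + j + 1) x - R (n + j) x) (R (n + j) x)
          have e1 : (1 / 2 : ℝ) ^ (n + (j + 1)) = (1 / 2) ^ (n + j) / 2 := by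
            rw [← add_assoc, pow_succ]; ring
          have p5 : (0 : ℝ) < (1 / 2) ^ (n + j) := by positivity
          have e2 : (2 : ℝ) ^ (n + (j + 1)) = 2 ^ (n + j) * 2 := by
            rw [← add_assoc, pow_succ]
          have p6 : (1 : ℝ) ≤ 2 ^ (n + j) := one_le_pow₀ (by norm_num)
          have p7 := half1 (n + j)
          rw [e1, e2, ← add_assoc]
          constructor
          · linarith [ih.1]
          · linarith [ih.2]
      have hc : CauchySeq (fun j => R (n + j) x) := by
        refine cauchySeq_of_le_geometric (1 / 2 : ℝ) 1 (by norm_num) (fun j => ?_)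
        rw [dist_comm, dist_eq_norm, one_mul]
        have a := h2 (n + j) (R (n + j) x) (fb j).2
        simp only [Equiv.symm_apply_apply] at a
        have : (1 / 2 : ℝ) ^ (n + j) ≤ (1 / 2) ^ j :=
          pow_le_pow_of_le_one (by norm_num) (by norm_num) (by omega)
        have p5 : (0 : ℝ) < (1 / 2) ^ (n + j) := by positivity
        rw [← add_assoc]
        linarith
      obtain ⟨z, hz⟩ := cauchySeq_tendsto_of_complete hc
      refine ⟨z, ?_⟩
      have hzn : ‖z‖ ≤ 2 ^ n + 1 := by
        refine le_of_tendsto hz.norm (Eventually.of_forall fun j => ?_)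
        have p5 : (0 : ℝ) < (1 / 2) ^ (n + j) := by positivity
        linarith [(fb j).1]
      obtain ⟨N, hN⟩ := big (2 ^ n + 4)
      have hN' := hN N le_rfl
      have hz' : Tendsto (fun m => R m x) atTop (𝓝 z) := by
        have : Tendsto (fun j => R (j + n) x) atTop (𝓝 z) := by
          refine hz.congr fun j => by rw [add_comm]
        exact (tendsto_add_atTop_iff_nat (f := fun m => R m x) n).1 this
      have hdist : Tendsto (fun m => ‖P N m (R m x) - P N m z‖) atTop (𝓝 0) := by
        have h0 : Tendsto (fun m => 2 * ‖R m x - z‖) atTop (𝓝 0) := by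
          have := ((hz'.sub_const z).norm).const_mul 2
          simpa using this
        refine squeeze_zero' (Eventually.of_forall fun _ => norm_nonneg _) ?_ h0
        filter_upwards [eventually_ge_atTop N, eventually_ge_atTop n] with m hm hm'
        obtain ⟨j, rfl⟩ := Nat.exists_eq_add_of_le hm'
        have p5 : (0 : ℝ) < (1 / 2) ^ (n + j) := by positivity
        exact lip N _ _ _ hm (by linarith [(fb j).1]) (by linarith)
      have hl : Tendsto (fun m => ‖P N m (R m x) - P N m z‖) atTop
          (𝓝 ‖R N x - R N (F z)‖) := by
        have : Tendsto (fun m => ‖R N x - P N m z‖) atTop (𝓝 ‖R N x - R N (F z)‖) :=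
          ((hFP N z).const_sub _).norm
        refine this.congr fun m => by simp [hP]
      have := tendsto_nhds_unique hl hdist
      exact ((R N).injective (sub_eq_zero.1 (norm_eq_zero.1 this))).symm

end Abstract

section OneVariable

/-- A cubic polynomial with superattracting fixed points `0` and `1`. -/
def cub (z : ℂ) : ℂ := z ^ 2 * (3 - 2 * z)

lemma cub_diff : Differentiable ℂ cub := by unfold cub; fun_prop

lemma cub_iter_zero (m : ℕ) : ∀ z : ℂ, ‖z‖ ≤ 1 / 5 → ‖cub^[m] z‖ ≤ (7 / 10 : ℝ) ^ m * (1 / 5) := by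
  induction m with
  | zero => intro z hz; simpa using hz
  | succ m ih =>
    intro z hz
    rw [Function.iterate_succ_apply']
    have h := ih z hz
    set w := cub^[m] z
    have h5 : ‖w‖ ≤ 1 / 5 := h.trans (by
      have : (7 / 10 : ℝ) ^ m ≤ 1 := pow_le_one₀ (by norm_num) (by norm_num)
      linarith)
    have h6 : ‖(3 : ℂ) - 2 * w‖ ≤ 3 + 2 * ‖w‖ := by
      refine (norm_sub_le _ _).trans ?_
      simp
    have h7 : ‖cub w‖ ≤ 7 / 10 * ‖w‖ := by
      unfold cub
      rw [norm_mul, norm_pow]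
      have := norm_nonneg w
      nlinarith [mul_le_mul_of_nonneg_left h6 (sq_nonneg ‖w‖)]
    rw [pow_succ]
    linarith

lemma cub_iter_symm (m : ℕ) (z : ℂ) : cub^[m] (1 - z) = 1 - cub^[m] z := by
  induction m with
  | zero => rfl
  | succ m ih =>
    rw [Function.iterate_succ_apply', Function.iterate_succ_apply', ih]
    unfold cub; ring

lemma exists_cub_iter (ε : ℝ) (hε : 0 < ε) : ∃ m, (∀ z : ℂ, ‖z‖ ≤ 1 / 5 → ‖cub^[m] z‖ ≤ ε) ∧
    (∀ z : ℂ, ‖z - 1‖ ≤ 1 / 5 → ‖cub^[m] z - 1‖ ≤ ε) := by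
  obtain ⟨m, hm⟩ := exists_pow_lt_of_lt_one hε (show (7 / 10 : ℝ) < 1 by norm_num)
  have h0 : ∀ z : ℂ, ‖z‖ ≤ 1 / 5 → ‖cub^[m] z‖ ≤ ε := fun z hz => by
    have := cub_iter_zero m z hz
    have : (0 : ℝ) < (7 / 10) ^ m := by positivity
    linarith
  refine ⟨m, h0, fun z hz => ?_⟩
  have h1 := h0 (1 - z) (by rwa [norm_sub_rev])
  rw [cub_iter_symm] at h1
  rwa [norm_sub_rev]

/-- Entire approximations of a step function on a strip. -/
lemma exists_step (s ε : ℝ) (hε : 0 < ε) : ∃ f : ℂ → ℂ, Differentiable ℂ f ∧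
    (∀ z : ℂ, |z.im| ≤ 2 → z.re ≤ s - 6 → ‖f z‖ ≤ ε) ∧
    (∀ z : ℂ, |z.im| ≤ 2 → s + 6 ≤ z.re → ‖f z - 1‖ ≤ ε) := by
  obtain ⟨m, hm0, hm1⟩ := exists_cub_iter ε hε
  have he3 : (10 : ℝ) ≤ Real.exp 3 := by
    have h1 : (2.7 : ℝ) ≤ Real.exp 1 := by linarith [Real.exp_one_gt_d9]
    have h2 : Real.exp 3 = Real.exp 1 ^ 3 := by rw [← Real.exp_nat_mul]; norm_num
    rw [h2]
    calc (10 : ℝ) ≤ 2.7 ^ 3 := by norm_num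
      _ ≤ _ := by gcongr
  refine ⟨fun z => cub^[m] (1 - Complex.exp (-Complex.exp ((z - s) / 2))), ?_, ?_, ?_⟩
  · exact (cub_diff.iterate m).comp (by fun_prop)
  · intro z hz hs
    apply hm0
    set w := Complex.exp ((z - s) / 2) with hw
    have hn : ‖w‖ ≤ 1 / 10 := by
      rw [hw, Complex.norm_exp]
      have h1 : ((z - s) / 2 : ℂ).re = (z.re - s) / 2 := by simp
      rw [h1]
      calc Real.exp ((z.re - s) / 2) ≤ Real.exp (-3) := Real.exp_le_exp.2 (by linarith)
        _ = (Real.exp 3)⁻¹ := Real.exp_neg 3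
        _ ≤ 10⁻¹ := by gcongr
        _ = 1 / 10 := by norm_num
    have h2 := Complex.norm_exp_sub_one_le (x := -w) (by rw [norm_neg]; linarith)
    rw [norm_sub_rev, norm_neg] at h2
    linarith
  · intro z hz hs
    apply hm1
    set w := Complex.exp ((z - s) / 2) with hw
    have h0 : ‖1 - Complex.exp (-w) - 1‖ = Real.exp (-w.re) := by
      rw [show 1 - Complex.exp (-w) - 1 = - Complex.exp (-w) by ring, norm_neg, Complex.norm_exp]
      simp
    rw [h0]
    have h3 : w.re = Real.exp ((z.re - s) / 2) * Real.cos (z.im / 2) := by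
      rw [hw, Complex.exp_re]; simp
    have h4 : 1 / 2 ≤ Real.cos (z.im / 2) := by
      have := Real.one_sub_sq_div_two_le_cos (x := z.im / 2)
      have h5 : z.im ^ 2 ≤ 2 ^ 2 := by rw [← sq_abs]; gcongr
      nlinarith
    have h6 : (10 : ℝ) ≤ Real.exp ((z.re - s) / 2) :=
      he3.trans (Real.exp_le_exp.2 (by linarith))
    have h7 : 5 ≤ w.re := by rw [h3]; nlinarith
    have h8 : Real.exp 5 ≥ 5 := by linarith [Real.add_one_le_exp 5]
    calc Real.exp (-w.re) ≤ Real.exp (-5) := Real.exp_le_exp.2 (by linarith)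
      _ = (Real.exp 5)⁻¹ := Real.exp_neg 5
      _ ≤ 5⁻¹ := by gcongr
      _ = 1 / 5 := by norm_num

lemma disc_bounds {z : ℂ} {c r : ℝ} (h : ‖z - c‖ ≤ r) :
    |z.im| ≤ r ∧ c - r ≤ z.re ∧ z.re ≤ c + r := by
  have h1 := (Complex.abs_im_le_norm (z - c)).trans h
  have h2 := (Complex.abs_re_le_norm (z - c)).trans h
  simp only [Complex.sub_im, Complex.ofReal_im, sub_zero, Complex.sub_re, Complex.ofReal_re] at h1 h2
  rw [abs_le] at h2
  exact ⟨h1, by linarith, by linarith⟩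

/-- Entire approximation of the locally constant function `32 l` on the disc about `32 l`. -/
lemma exists_locConst (N : ℕ) (ε : ℝ) (hε : 0 < ε) : ∃ f : ℂ → ℂ, Differentiable ℂ f ∧
    ∀ l < N, ∀ z : ℂ, ‖z - ((32 * l : ℝ) : ℂ)‖ ≤ 2 → ‖f z - ((32 * l : ℝ) : ℂ)‖ ≤ ε := by
  have hN : (0 : ℝ) < 32 * (N + 1) := by positivity
  set δ := ε / (32 * (N + 1)) with hδ
  have hδ0 : 0 < δ := by positivity
  choose g hgd hg0 hg1 using fun j : ℕ => exists_step (32 * j + 16) δ hδ0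
  refine ⟨fun z => ∑ j ∈ Finset.range N, 32 * g j z, ?_, ?_⟩
  · exact Differentiable.fun_sum fun j _ => (hgd j).const_mul 32
  · intro l hl z hz
    obtain ⟨b1, b2, b3⟩ := disc_bounds hz
    have hsum : ((32 * l : ℝ) : ℂ) = ∑ j ∈ Finset.range N, 32 * (if j < l then (1 : ℂ) else 0) := by
      rw [← Finset.mul_sum, Finset.sum_ite]
      have : (Finset.range N).filter (· < l) = Finset.range l := by
        ext j; simp; omega
      simp [this]
    rw [hsum, ← Finset.sum_sub_distrib]
    refine (norm_sum_le _ _).trans ?_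
    have hterm : ∀ j ∈ Finset.range N, ‖32 * g j z - 32 * (if j < l then (1 : ℂ) else 0)‖ ≤ 32 * δ := by
      intro j _
      rw [← mul_sub, norm_mul]
      have : ‖(32 : ℂ)‖ = 32 := by simp
      rw [this]
      gcongr
      split_ifs with h
      · have : (j : ℝ) + 1 ≤ l := by exact_mod_cast h
        exact hg1 j z b1 (by linarith)
      · have : (l : ℝ) ≤ j := by exact_mod_cast (not_lt.1 h)
        simpa using hg0 j z b1 (by linarith)
    refine (Finset.sum_le_sum hterm).trans ?_
    rw [Finset.sum_const, Finset.card_range, nsmul_eq_mul]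
    have : 32 * (N + 1) * δ = ε := by rw [hδ]; field_simp
    nlinarith

/-- Bump functions. -/
lemma exists_bump (l : ℤ) (ε : ℝ) (hε : 0 < ε) : ∃ f : ℂ → ℂ, Differentiable ℂ f ∧
    (∀ z : ℂ, |z.im| ≤ 2 → |z.re - 32 * l| ≤ 16 → ‖f z - 1‖ ≤ ε) ∧
    (∀ j : ℕ, (j : ℤ) ≠ l → ∀ z : ℂ, ‖z - ((32 * j : ℝ) : ℂ)‖ ≤ 2 → ‖f z‖ ≤ ε) := by
  obtain ⟨g, gd, g0, g1⟩ := exists_step (32 * l - 22) (ε / 2) (by positivity)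
  obtain ⟨h, hd, h0, h1⟩ := exists_step (32 * l + 22) (ε / 2) (by positivity)
  refine ⟨fun z => g z - h z, gd.sub hd, ?_, ?_⟩
  · intro z hz hr
    rw [abs_le] at hr
    have a := g1 z hz (by linarith)
    have b := h0 z hz (by linarith)
    rw [show g z - h z - 1 = (g z - 1) - h z by ring]
    refine (norm_sub_le _ _).trans (by linarith)
  · intro j hj z hz
    obtain ⟨b1, b2, b3⟩ := disc_bounds hz
    rcases lt_or_gt_of_ne hj with hj | hj
    · have : (j : ℝ) + 1 ≤ l := by exact_mod_cast hj
      have a := g0 z b1 (by linarith)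
      have b := h0 z b1 (by linarith)
      refine (norm_sub_le _ _).trans (by linarith)
    · have : (l : ℝ) + 1 ≤ j := by exact_mod_cast hj
      have a := g1 z b1 (by linarith)
      have b := h1 z b1 (by linarith)
      change ‖g z - h z‖ ≤ ε
      rw [show g z - h z = (g z - 1) - (h z - 1) by ring]
      refine (norm_sub_le _ _).trans (by linarith)

/-- A Runge-type peak lemma for the discs of radius one about `0, 32, 64, …` and a point outside. -/
lemma exists_peak (N : ℕ) (x : ℂ) (hx : ∀ l < N, 1 < ‖x - ((32 * l : ℝ) : ℂ)‖) :
    ∃ r : ℝ, 1 < r ∧ ∀ ε > 0, ∃ f : ℂ → ℂ, Differentiable ℂ f ∧ f x = 1 ∧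
      ∀ l < N, ∀ z : ℂ, ‖z - ((32 * l : ℝ) : ℂ)‖ ≤ r → ‖f z‖ ≤ ε := by
  by_cases him : 1 < |x.im|
  · -- exponentials
    obtain ⟨r, hr1, hr2⟩ := exists_between him
    refine ⟨r, hr1, fun ε hε => ?_⟩
    obtain ⟨n, hn⟩ := exists_pow_lt_of_lt_one hε
      (show Real.exp (r - |x.im|) < 1 by rw [Real.exp_lt_one_iff]; linarith)
    obtain ⟨s, hs, hs'⟩ : ∃ s : ℝ, |s| = 1 ∧ s * x.im = |x.im| := by
      rcases le_total 0 x.im with h | h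
      · exact ⟨1, by simp, by rw [abs_of_nonneg h]; ring⟩
      · exact ⟨-1, by simp, by rw [abs_of_nonpos h]; ring⟩
    refine ⟨fun z => (Complex.exp (-(s * Complex.I) * (z - x))) ^ n, by fun_prop, by simp, ?_⟩
    intro l _ z hz
    obtain ⟨b1, -, -⟩ := disc_bounds hz
    rw [norm_pow, Complex.norm_exp]
    have h1 : (-(s * Complex.I) * (z - x)).re = s * z.im - s * x.im := by simp; ring
    have h2 : s * z.im ≤ r := by
      refine (le_abs_self _).trans ?_
      rw [abs_mul, hs, one_mul]; exact b1
    rw [h1, hs']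
    refine le_trans ?_ hn.le
    gcongr
  · push Not at him
    set l : ℤ := round (x.re / 32) with hl
    have hxl : |x.re - 32 * l| ≤ 16 := by
      have := abs_sub_round (x.re / 32)
      rw [abs_le] at this ⊢
      rw [← hl] at this
      constructor <;> linarith [this.1, this.2]
    -- the sharp factor
    obtain ⟨r, hr1, hr2, hw⟩ : ∃ r : ℝ, 1 < r ∧ r ≤ 2 ∧ ∀ ε > 0, ∃ w : ℂ → ℂ, Differentiable ℂ w ∧
        w x = 1 ∧ ∀ j < N, (j : ℤ) = l → ∀ z : ℂ, ‖z - ((32 * j : ℝ) : ℂ)‖ ≤ r → ‖w z‖ ≤ ε := by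
      by_cases hex : ∃ j < N, (j : ℤ) = l
      · obtain ⟨j, hjN, hjl⟩ := hex
        obtain ⟨r, hra, hrb⟩ := exists_between (lt_min (hx j hjN) (show (1 : ℝ) < 2 by norm_num))
        have hpos : 0 < ‖x - ((32 * j : ℝ) : ℂ)‖ := one_pos.trans (hx j hjN)
        refine ⟨r, hra, (hrb.trans_le (min_le_right _ _)).le, fun ε hε => ?_⟩
        obtain ⟨n, hn⟩ := exists_pow_lt_of_lt_one hε
          (show r / ‖x - ((32 * j : ℝ) : ℂ)‖ < 1 by
            rw [div_lt_one hpos]; exact hrb.trans_le (min_le_left _ _))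
        refine ⟨fun z => ((z - ((32 * j : ℝ) : ℂ)) / (x - ((32 * j : ℝ) : ℂ))) ^ n, ?_, ?_, ?_⟩
        · fun_prop
        · have : (x - ((32 * j : ℝ) : ℂ)) ≠ 0 := norm_pos_iff.1 hpos
          simp only [div_self this, one_pow]
        · intro j' _ hj' z hz
          obtain rfl : j' = j := by exact_mod_cast hj'.trans hjl.symm
          rw [norm_pow, norm_div]
          refine le_trans ?_ hn.le
          gcongr
      · refine ⟨2, by norm_num, le_rfl, fun ε hε => ⟨fun _ => 1, by fun_prop, rfl, ?_⟩⟩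
        intro j hj hjl
        exact absurd ⟨j, hj, hjl⟩ hex
    refine ⟨r, hr1, fun ε hε => ?_⟩
    obtain ⟨w, wd, wx, wl⟩ := hw (ε / 4) (by positivity)
    obtain ⟨B, hB⟩ := (isCompact_closedBall (0 : ℂ) (32 * N + 2)).exists_bound_of_continuousOn
      wd.continuous.continuousOn
    have hB0 : 0 ≤ B := (norm_nonneg _).trans (hB 0 (by simp; positivity))
    set δ := min (1 / 2) (ε / (2 * (B + 1))) with hδ
    have hδ0 : 0 < δ := by positivity
    obtain ⟨g, gd, g1, g0⟩ := exists_bump l δ hδ0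
    have hgx : 1 / 2 ≤ ‖g x‖ := by
      have h1 := g1 x (by linarith) hxl
      have h2 : δ ≤ 1 / 2 := min_le_left _ _
      have h3 : ‖(1 : ℂ)‖ ≤ ‖g x‖ + ‖g x - 1‖ := by
        have := norm_sub_le (g x) (g x - 1)
        simpa using this
      rw [norm_one] at h3
      linarith
    have hgx0 : g x ≠ 0 := norm_pos_iff.1 (by linarith)
    refine ⟨fun z => g z / g x * w z, ?_, ?_, ?_⟩
    · exact (gd.div_const _).mul wd
    · simp [hgx0, wx]
    · intro j hj z hz
      rw [norm_mul, norm_div]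
      by_cases hjl : (j : ℤ) = l
      · have h1 := wl j hj hjl z hz
        obtain ⟨b1, b2, b3⟩ := disc_bounds hz
        have hjl' : (l : ℝ) = j := by rw [← hjl]; simp
        have h2 := g1 z (by linarith) (by rw [hjl', abs_le]; constructor <;> linarith)
        have h3 : δ ≤ 1 / 2 := min_le_left _ _
        have h4 : ‖g z‖ ≤ 2 := by
          have := norm_add_le (g z - 1) 1
          simp only [sub_add_cancel, norm_one] at this
          linarith
        calc ‖g z‖ / ‖g x‖ * ‖w z‖ ≤ 2 / (1 / 2) * (ε / 4) := by gcongr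
          _ = ε := by ring
      · have h2 := g0 j hjl z (hz.trans hr2)
        have hjN : (j : ℝ) ≤ N := by exact_mod_cast hj.le
        have h5 : ‖w z‖ ≤ B := by
          apply hB
          rw [mem_closedBall_zero_iff]
          have := norm_add_le (z - ((32 * j : ℝ) : ℂ)) ((32 * j : ℝ) : ℂ)
          rw [sub_add_cancel, Complex.norm_real, Real.norm_of_nonneg (by positivity)] at this
          linarith
        have h3 : δ ≤ ε / (2 * (B + 1)) := min_le_right _ _
        calc ‖g z‖ / ‖g x‖ * ‖w z‖ ≤ (ε / (2 * (B + 1))) / (1 / 2) * (B + 1) := by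
              gcongr
              · exact h2.trans h3
              · linarith
          _ = ε := by field_simp

end OneVariable

section Automorphisms

set_option linter.unusedSectionVars false
set_option linter.unusedSimpArgs false

variable {ι : Type*} [Fintype ι] [DecidableEq ι]

/-- Holomorphic automorphisms. -/
def IsAut (e : (ι → ℂ) ≃ (ι → ℂ)) : Prop := Differentiable ℂ e ∧ Differentiable ℂ e.symm

lemma IsAut.refl : IsAut (Equiv.refl (ι → ℂ)) := ⟨differentiable_id, differentiable_id⟩

lemma IsAut.trans {e f : (ι → ℂ) ≃ (ι → ℂ)} (he : IsAut e) (hf : IsAut f) : IsAut (e.trans f) :=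
  ⟨hf.1.comp he.1, he.2.comp hf.2⟩

/-- Shears. -/
def shear (a : ι) (v : ι → ℂ) (hv : v a = 0) (f : ℂ → ℂ) : (ι → ℂ) ≃ (ι → ℂ) where
  toFun z := z + f (z a) • v
  invFun z := z - f (z a) • v
  left_inv z := by simp [hv]
  right_inv z := by simp [hv]

lemma shear_apply (a : ι) (v : ι → ℂ) (hv : v a = 0) (f : ℂ → ℂ) (z : ι → ℂ) :
    shear a v hv f z = z + f (z a) • v := rfl

lemma shear_symm_apply (a : ι) (v : ι → ℂ) (hv : v a = 0) (f : ℂ → ℂ) (z : ι → ℂ) :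
    (shear a v hv f).symm z = z - f (z a) • v := rfl

lemma shear_isAut (a : ι) (v : ι → ℂ) (hv : v a = 0) (f : ℂ → ℂ) (hf : Differentiable ℂ f) :
    IsAut (shear a v hv f) := by
  have h1 : Differentiable ℂ (fun z : ι → ℂ => f (z a)) :=
    hf.comp (by fun_prop : Differentiable ℂ (fun z : ι → ℂ => z a))
  refine ⟨?_, ?_⟩
  · change Differentiable ℂ (fun z : ι → ℂ => z + f (z a) • v)
    fun_prop
  · change Differentiable ℂ (fun z : ι → ℂ => z - f (z a) • v)
    fun_prop

/-- The dilation by `1/2`. -/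
def halving : (ι → ℂ) ≃ (ι → ℂ) where
  toFun z := (1 / 2 : ℂ) • z
  invFun z := (2 : ℂ) • z
  left_inv z := by simp [smul_smul]
  right_inv z := by simp [smul_smul]

lemma halving_isAut : IsAut (halving (ι := ι)) := by
  refine ⟨?_, ?_⟩
  · change Differentiable ℂ (fun z : ι → ℂ => (1 / 2 : ℂ) • z)
    fun_prop
  · change Differentiable ℂ (fun z : ι → ℂ => (2 : ℂ) • z)
    fun_prop

/-- The centers of the attracting polydiscs. -/
def ctr (i0 : ι) (l : ℕ) : ι → ℂ := Pi.single i0 ((32 * l : ℝ) : ℂ)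

lemma ctr_same (i0 : ι) (l : ℕ) : ctr i0 l i0 = ((32 * l : ℝ) : ℂ) := by simp [ctr]

lemma ctr_ne (i0 : ι) (l : ℕ) {c : ι} (h : c ≠ i0) : ctr i0 l c = 0 := by simp [ctr, h]

lemma coord_le {x y : ι → ℂ} {r : ℝ} (h : ‖x - y‖ ≤ r) (c : ι) : ‖x c - y c‖ ≤ r :=
  (norm_le_pi_norm (x - y) c).trans h

/-- `x` can be moved to `y` by automorphisms arbitrarily close to the identity on neighbourhoods
of the first `N` unit polydiscs. -/
def Pushable (N : ℕ) (i0 : ι) (x y : ι → ℂ) : Prop :=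
  ∃ r : ℝ, 1 < r ∧ ∀ ε > 0, ∃ φ : (ι → ℂ) ≃ (ι → ℂ), IsAut φ ∧ φ x = y ∧
    ∀ l < N, ∀ z, ‖z - ctr i0 l‖ ≤ r → ‖φ z - z‖ ≤ ε ∧ ‖φ.symm z - z‖ ≤ ε

lemma Pushable.trans {N : ℕ} {i0 : ι} {x y w : ι → ℂ} (h1 : Pushable N i0 x y)
    (h2 : Pushable N i0 y w) : Pushable N i0 x w := by
  obtain ⟨r1, hr1, H1⟩ := h1
  obtain ⟨r2, hr2, H2⟩ := h2
  obtain ⟨r, hr, hr'⟩ := exists_between (lt_min hr1 hr2)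
  have hra := hr'.trans_le (min_le_left _ _)
  have hrb := hr'.trans_le (min_le_right _ _)
  refine ⟨r, hr, fun ε hε => ?_⟩
  have hδ : 0 < min (ε / 2) (min (r1 - r) (r2 - r)) :=
    lt_min (by positivity) (lt_min (by linarith) (by linarith))
  set δ := min (ε / 2) (min (r1 - r) (r2 - r)) with hδd
  have d1 : δ ≤ ε / 2 := min_le_left _ _
  have d2 : δ ≤ r1 - r := (min_le_right _ _).trans (min_le_left _ _)
  have d3 : δ ≤ r2 - r := (min_le_right _ _).trans (min_le_right _ _)
  obtain ⟨φ, φa, φx, hφ⟩ := H1 δ hδ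
  obtain ⟨ψ, ψa, ψy, hψ⟩ := H2 δ hδ
  refine ⟨φ.trans ψ, φa.trans ψa, by simp [φx, ψy], ?_⟩
  intro l hl z hz
  constructor
  · have a := (hφ l hl z (by linarith)).1
    have b : ‖φ z - ctr i0 l‖ ≤ r2 := by
      have := norm_add_le (φ z - z) (z - ctr i0 l)
      rw [sub_add_sub_cancel] at this
      linarith
    have c := (hψ l hl _ b).1
    have := norm_add_le (ψ (φ z) - φ z) (φ z - z)
    rw [sub_add_sub_cancel] at this
    simp only [Equiv.trans_apply]
    linarith
  · have a := (hψ l hl z (by linarith)).2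
    have b : ‖ψ.symm z - ctr i0 l‖ ≤ r1 := by
      have := norm_add_le (ψ.symm z - z) (z - ctr i0 l)
      rw [sub_add_sub_cancel] at this
      linarith
    have c := (hφ l hl _ b).2
    have := norm_add_le (φ.symm (ψ.symm z) - ψ.symm z) (ψ.symm z - z)
    rw [sub_add_sub_cancel] at this
    simp only [Equiv.symm_trans_apply]
    linarith

lemma pushable_shear {N : ℕ} {i0 : ι} {x v : ι → ℂ} (a : ι) (hv : v a = 0)
    (H : ∃ r : ℝ, 1 < r ∧ ∀ ε > 0, ∃ f : ℂ → ℂ, Differentiable ℂ f ∧ f (x a) = 1 ∧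
      ∀ l < N, ∀ z : ℂ, ‖z - ctr i0 l a‖ ≤ r → ‖f z‖ ≤ ε) : Pushable N i0 x (x + v) := by
  obtain ⟨r, hr, H⟩ := H
  refine ⟨r, hr, fun ε hε => ?_⟩
  obtain ⟨f, fd, fx, hf⟩ := H (ε / (‖v‖ + 1)) (by positivity)
  refine ⟨shear a v hv f, shear_isAut a v hv f fd, by simp [shear_apply, fx], ?_⟩
  intro l hl z hz
  have h1 := hf l hl (z a) (coord_le hz a)
  have h2 : ‖f (z a) • v‖ ≤ ε := by
    rw [norm_smul]
    calc ‖f (z a)‖ * ‖v‖ ≤ ε / (‖v‖ + 1) * (‖v‖ + 1) := by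
          gcongr
          linarith
      _ = ε := by field_simp
  constructor
  · rw [shear_apply, add_sub_cancel_left]; exact h2
  · rw [shear_symm_apply, sub_sub_cancel_left, norm_neg]; exact h2

lemma pushable_power {N : ℕ} {i0 : ι} {x v : ι → ℂ} (a : ι) (ha : a ≠ i0) (hv : v a = 0)
    (hx : 1 < ‖x a‖) : Pushable N i0 x (x + v) := by
  refine pushable_shear a hv ?_
  obtain ⟨r, hr, hr'⟩ := exists_between hx
  refine ⟨r, hr, fun ε hε => ?_⟩
  have hpos : 0 < ‖x a‖ := by linarith
  obtain ⟨n, hn⟩ := exists_pow_lt_of_lt_one hε (show r / ‖x a‖ < 1 by rwa [div_lt_one hpos])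
  refine ⟨fun z => (z / x a) ^ n, by fun_prop, ?_, ?_⟩
  · have : x a ≠ 0 := norm_pos_iff.1 hpos
    simp [this]
  · intro l _ z hz
    rw [ctr_ne i0 l ha, sub_zero] at hz
    rw [norm_pow, norm_div]
    refine le_trans ?_ hn.le
    gcongr

lemma pushable_base {N : ℕ} {i0 : ι} {x v : ι → ℂ} (hv : v i0 = 0)
    (hx : ∀ l < N, 1 < ‖x i0 - ((32 * l : ℝ) : ℂ)‖) : Pushable N i0 x (x + v) := by
  refine pushable_shear i0 hv ?_
  obtain ⟨r, hr, H⟩ := exists_peak N (x i0) hx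
  refine ⟨r, hr, fun ε hε => ?_⟩
  obtain ⟨f, h1, h2, h3⟩ := H ε hε
  refine ⟨f, h1, h2, fun l hl z hz => h3 l hl z ?_⟩
  rwa [ctr_same] at hz

lemma pushable_main {N : ℕ} {i0 i1 : ι} (h01 : i1 ≠ i0) (x y : ι → ℂ) (hy : y i1 = 3 / 2)
    (hx : ∀ l < N, 1 < ‖x - ctr i0 l‖) : Pushable N i0 x y := by
  -- first the case in which the coordinate `i0` is outside of all discs
  have main : ∀ x : ι → ℂ, (∀ l < N, 1 < ‖x i0 - ((32 * l : ℝ) : ℂ)‖) → Pushable N i0 x y := by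
    intro x hx
    have s1 : Pushable N i0 x (x + Pi.single i1 (3 / 2 - x i1)) :=
      pushable_base (by simp [h01.symm]) hx
    set x' := x + Pi.single i1 (3 / 2 - x i1) with hx'
    have hx'1 : x' i1 = 3 / 2 := by simp [hx']
    have s2 : Pushable N i0 x' (x' + (y - x')) := by
      refine pushable_power i1 h01 (by simp [hy, hx'1]) ?_
      rw [hx'1]; norm_num
    rw [add_sub_cancel] at s2
    exact s1.trans s2
  by_cases h : ∀ l < N, 1 < ‖x i0 - ((32 * l : ℝ) : ℂ)‖
  · exact main x h
  · push Not at h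
    obtain ⟨l, hl, hle⟩ := h
    have hex : ∃ c, 1 < ‖x c - ctr i0 l c‖ := by
      by_contra hcon
      push Not at hcon
      have := (pi_norm_le_iff_of_nonneg (x := x - ctr i0 l) zero_le_one).2 hcon
      linarith [hx l hl]
    obtain ⟨c, hc⟩ := hex
    have hc0 : c ≠ i0 := by
      rintro rfl
      rw [ctr_same] at hc
      linarith
    rw [ctr_ne i0 l hc0, sub_zero] at hc
    have s1 : Pushable N i0 x (x + Pi.single i0 (5 * Complex.I - x i0)) :=
      pushable_power c hc0 (by simp [hc0]) hc
    refine s1.trans (main _ ?_)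
    intro j _
    have h5 : (x + Pi.single i0 (5 * Complex.I - x i0) : ι → ℂ) i0 = 5 * Complex.I := by simp
    rw [h5]
    have := Complex.abs_im_le_norm (5 * Complex.I - ((32 * j : ℝ) : ℂ))
    have h6 : (5 * Complex.I - ((32 * j : ℝ) : ℂ)).im = 5 := by simp
    rw [h6] at this
    norm_num at this ⊢
    linarith

lemma norm_smul_single (i : ι) (t : ℂ) : ‖t • (Pi.single i 1 : ι → ℂ)‖ = ‖t‖ := by
  rw [norm_smul, Pi.norm_single, norm_one, mul_one]

/-- The simultaneous approximate contraction. -/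
lemma exists_kappa (N : ℕ) {i0 i1 : ι} (h01 : i1 ≠ i0) (ε : ℝ) (hε : 0 < ε) :
    ∃ κ : (ι → ℂ) ≃ (ι → ℂ), IsAut κ ∧ ∀ l < N,
      (∀ z, ‖z - ctr i0 l‖ ≤ 8 / 5 → ‖κ z - (1 / 2 : ℂ) • (z + ctr i0 l)‖ ≤ ε) ∧
      (∀ w, ‖w - ctr i0 l‖ ≤ 1 / 2 → ‖κ.symm w - ((2 : ℂ) • w - ctr i0 l)‖ ≤ ε) := by
  set δ := min (ε / 3) (1 / 10) with hδ
  have hδ0 : 0 < δ := by positivity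
  have d1 : δ ≤ ε / 3 := min_le_left _ _
  have d2 : δ ≤ 1 / 10 := min_le_right _ _
  obtain ⟨f, fd, hf⟩ := exists_locConst N δ hδ0
  set e0 : ι → ℂ := Pi.single i0 1 with he0
  set e1 : ι → ℂ := Pi.single i1 1 with he1
  have e00 : e0 i0 = 1 := by simp [he0]
  have e01 : e0 i1 = 0 := by simp [he0, h01]
  have e10 : e1 i0 = 0 := by simp [he1, h01.symm]
  have e11 : e1 i1 = 1 := by simp [he1]
  set S1 := shear i0 e1 e10 f
  set S2 := shear i1 e0 e01 f
  set S3 := shear i0 e1 e10 (fun t => - f (t / 2))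
  refine ⟨((S1.trans S2).trans S3).trans halving, ?_, ?_⟩
  · refine (((shear_isAut _ _ _ _ fd).trans (shear_isAut _ _ _ _ fd)).trans
      (shear_isAut _ _ _ _ ?_)).trans halving_isAut
    exact (fd.comp (by fun_prop : Differentiable ℂ (fun t : ℂ => t / 2))).neg
  intro l hl
  set c : ℂ := ((32 * l : ℝ) : ℂ) with hc
  have hctr : ctr i0 l = c • e0 := by
    rw [he0, ← Pi.single_smul, smul_eq_mul, mul_one]; rfl
  constructor
  · intro z hz
    have z0 : ‖z i0 - c‖ ≤ 8 / 5 := by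
      have := coord_le hz i0
      rwa [ctr_same] at this
    have z1 : ‖z i1‖ ≤ 8 / 5 := by simpa [ctr_ne i0 l h01] using coord_le hz i1
    have a1 : ‖f (z i0) - c‖ ≤ δ := hf l hl _ (by linarith)
    have a2 : ‖f (z i1 + f (z i0)) - c‖ ≤ δ := hf l hl _ (by
      rw [add_sub_assoc]
      refine (norm_add_le _ _).trans (by linarith))
    have a3 : ‖f ((z i0 + f (z i1 + f (z i0))) / 2) - c‖ ≤ δ := hf l hl _ (by
      rw [show (z i0 + f (z i1 + f (z i0))) / 2 - c
        = ((z i0 - c) + (f (z i1 + f (z i0)) - c)) / 2 by ring, norm_div]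
      have := norm_add_le (z i0 - c) (f (z i1 + f (z i0)) - c)
      rw [Complex.norm_ofNat]
      linarith)
    have heq : (((S1.trans S2).trans S3).trans halving) z - (1 / 2 : ℂ) • (z + ctr i0 l)
        = (1 / 2 : ℂ) • ((f (z i0) - c) • e1 - (f ((z i0 + f (z i1 + f (z i0))) / 2) - c) • e1
          + (f (z i1 + f (z i0)) - c) • e0) := by
      simp only [Equiv.trans_apply, halving, Equiv.coe_fn_mk, S1, S2, S3, shear_apply, hctr,
        Pi.add_apply, Pi.smul_apply, e00, e01, e10, e11, smul_eq_mul, mul_zero, mul_one, add_zero]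
      module
    rw [heq, norm_smul]
    have b1 : ‖(f (z i0) - c) • e1‖ ≤ δ := by rw [he1, norm_smul_single]; exact a1
    have b2 : ‖(f (z i1 + f (z i0)) - c) • e0‖ ≤ δ := by rw [he0, norm_smul_single]; exact a2
    have b3 : ‖(f ((z i0 + f (z i1 + f (z i0))) / 2) - c) • e1‖ ≤ δ := by
      rw [he1, norm_smul_single]; exact a3
    have b4 := norm_add_le ((f (z i0) - c) • e1 -
      (f ((z i0 + f (z i1 + f (z i0))) / 2) - c) • e1) ((f (z i1 + f (z i0)) - c) • e0)
    have b5 := norm_sub_le ((f (z i0) - c) • e1)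
      ((f ((z i0 + f (z i1 + f (z i0))) / 2) - c) • e1)
    have b6 : ‖(1 / 2 : ℂ)‖ = 1 / 2 := by simp
    rw [b6]
    linarith
  · intro w hw
    have z0 : ‖w i0 - c‖ ≤ 1 / 2 := by
      have := coord_le hw i0
      rwa [ctr_same] at this
    have z1 : ‖w i1‖ ≤ 1 / 2 := by simpa [ctr_ne i0 l h01] using coord_le hw i1
    have n2 : ‖(2 : ℂ)‖ = 2 := by simp
    have a1 : ‖f (w i0) - c‖ ≤ δ := hf l hl _ (by linarith)
    have a2 : ‖f (2 * w i1 + f (w i0)) - c‖ ≤ δ := hf l hl _ (by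
      rw [add_sub_assoc]
      refine (norm_add_le _ _).trans ?_
      rw [norm_mul, n2]
      linarith)
    have a3 : ‖f (2 * w i0 - f (2 * w i1 + f (w i0))) - c‖ ≤ δ := hf l hl _ (by
      rw [show 2 * w i0 - f (2 * w i1 + f (w i0)) - c
        = 2 * (w i0 - c) - (f (2 * w i1 + f (w i0)) - c) by ring]
      refine (norm_sub_le _ _).trans ?_
      rw [norm_mul, n2]
      linarith)
    have heq : (((S1.trans S2).trans S3).trans halving).symm w - ((2 : ℂ) • w - ctr i0 l)
        = (f (w i0) - c) • e1 - (f (2 * w i0 - f (2 * w i1 + f (w i0))) - c) • e1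
          - (f (2 * w i1 + f (w i0)) - c) • e0 := by
      have h2 : (2 * w i0) / 2 = w i0 := by ring
      simp only [Equiv.symm_trans_apply, halving, Equiv.coe_fn_symm_mk, S1, S2, S3,
        shear_symm_apply, hctr, Pi.add_apply, Pi.sub_apply, Pi.smul_apply, e00, e01, e10, e11,
        smul_eq_mul, mul_zero, mul_one, add_zero, sub_zero, h2, sub_neg_eq_add]
      module
    rw [heq]
    have b1 : ‖(f (w i0) - c) • e1‖ ≤ δ := by rw [he1, norm_smul_single]; exact a1
    have b2 : ‖(f (2 * w i1 + f (w i0)) - c) • e0‖ ≤ δ := by rw [he0, norm_smul_single]; exact a2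
    have b3 : ‖(f (2 * w i0 - f (2 * w i1 + f (w i0))) - c) • e1‖ ≤ δ := by
      rw [he1, norm_smul_single]; exact a3
    have b4 := norm_sub_le ((f (w i0) - c) • e1 -
      (f (2 * w i0 - f (2 * w i1 + f (w i0))) - c) • e1) ((f (2 * w i1 + f (w i0)) - c) • e0)
    have b5 := norm_sub_le ((f (w i0) - c) • e1)
      ((f (2 * w i0 - f (2 * w i1 + f (w i0))) - c) • e1)
    linarith

/-- The key automorphism. -/
lemma exists_phi (N : ℕ) {i0 i1 : ι} (h01 : i1 ≠ i0) (ε : ℝ) (hε : 0 < ε) (x : ι → ℂ) (i : ℕ)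
    (hi : i < N) :
    ∃ φ : (ι → ℂ) ≃ (ι → ℂ), IsAut φ ∧
      ((∀ l < N, 1 < ‖x - ctr i0 l‖) → ‖φ x - ctr i0 i‖ < 1) ∧ ∀ l < N,
      (∀ z, ‖z - ctr i0 l‖ ≤ 1 → ‖φ z - (1 / 2 : ℂ) • (z + ctr i0 l)‖ ≤ ε) ∧
      (∀ w, ‖w - ctr i0 l‖ ≤ 1 / 2 → ‖φ.symm w - ((2 : ℂ) • w - ctr i0 l)‖ ≤ ε) := by
  by_cases hx : ∀ l < N, 1 < ‖x - ctr i0 l‖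
  · set y : ι → ℂ := ctr i0 i + Pi.single i1 (3 / 2) with hy
    obtain ⟨r, hr, H⟩ := pushable_main h01 x y (by simp [hy, ctr_ne i0 i h01]) hx
    have hδ0 : 0 < min (ε / 2) (min (1 / 10) (r - 1)) :=
      lt_min (by positivity) (lt_min (by norm_num) (by linarith))
    set δ := min (ε / 2) (min (1 / 10) (r - 1)) with hδ
    have d1 : δ ≤ ε / 2 := min_le_left _ _
    have d2 : δ ≤ 1 / 10 := (min_le_right _ _).trans (min_le_left _ _)
    have d3 : δ ≤ r - 1 := (min_le_right _ _).trans (min_le_right _ _)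
    obtain ⟨ψ, ψa, ψx, hψ⟩ := H δ hδ0
    obtain ⟨κ, κa, hκ⟩ := exists_kappa N h01 δ hδ0
    refine ⟨ψ.trans κ, ψa.trans κa, fun _ => ?_, fun l hl => ⟨fun z hz => ?_, fun w hw => ?_⟩⟩
    · rw [Equiv.trans_apply, ψx]
      have e1 : y - ctr i0 i = Pi.single i1 (3 / 2) := by rw [hy, add_sub_cancel_left]
      have n1 : ‖(Pi.single i1 (3 / 2) : ι → ℂ)‖ = 3 / 2 := by
        rw [Pi.norm_single]; norm_num
      have h1 := (hκ i hi).1 y (by rw [e1, n1]; norm_num)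
      have h2 : κ y - ctr i0 i = (κ y - (1 / 2 : ℂ) • (y + ctr i0 i))
          + (1 / 2 : ℂ) • (Pi.single i1 (3 / 2) : ι → ℂ) := by
        rw [hy]; module
      rw [h2]
      refine (norm_add_le _ _).trans_lt ?_
      have b6 : ‖(1 / 2 : ℂ)‖ = 1 / 2 := by simp
      rw [norm_smul, n1, b6]
      linarith
    · have h1 := (hψ l hl z (by linarith)).1
      have h2 : ‖ψ z - ctr i0 l‖ ≤ 8 / 5 := by
        have := norm_add_le (ψ z - z) (z - ctr i0 l)
        rw [sub_add_sub_cancel] at this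
        linarith
      have h3 := (hκ l hl).1 _ h2
      rw [Equiv.trans_apply]
      have h4 : κ (ψ z) - (1 / 2 : ℂ) • (z + ctr i0 l)
          = (κ (ψ z) - (1 / 2 : ℂ) • (ψ z + ctr i0 l)) + (1 / 2 : ℂ) • (ψ z - z) := by module
      rw [h4]
      refine (norm_add_le _ _).trans ?_
      have b6 : ‖(1 / 2 : ℂ)‖ = 1 / 2 := by simp
      rw [norm_smul, b6]
      linarith
    · have h1 := (hκ l hl).2 w hw
      have h2 : ‖κ.symm w - ctr i0 l‖ ≤ r := by
        have h4 : κ.symm w - ctr i0 l = (κ.symm w - ((2 : ℂ) • w - ctr i0 l))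
          + (2 : ℂ) • (w - ctr i0 l) := by module
        rw [h4]
        refine (norm_add_le _ _).trans ?_
        have b6 : ‖(2 : ℂ)‖ = 2 := by simp
        rw [norm_smul, b6]
        linarith
      have h3 := (hψ l hl _ h2).2
      rw [Equiv.symm_trans_apply]
      have := norm_add_le (ψ.symm (κ.symm w) - κ.symm w) (κ.symm w - ((2 : ℂ) • w - ctr i0 l))
      rw [sub_add_sub_cancel] at this
      linarith
  · obtain ⟨κ, κa, hκ⟩ := exists_kappa N h01 ε hε
    exact ⟨κ, κa, fun h => absurd h hx, fun l hl =>
      ⟨fun z hz => (hκ l hl).1 z (by linarith), (hκ l hl).2⟩⟩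

end Automorphisms

section Construction

variable {ι : Type*} [Fintype ι] [DecidableEq ι]

set_option linter.unusedSectionVars false

/-- The affine rescaling about `a`. -/
def rescale (a : ι → ℂ) (m : ℕ) : (ι → ℂ) ≃ (ι → ℂ) where
  toFun y := (2 ^ m : ℂ) • (y - a)
  invFun w := a + ((1 / 2) ^ m : ℂ) • w
  left_inv y := by
    simp only [smul_smul]
    rw [← mul_pow]; norm_num
  right_inv w := by
    simp only [add_sub_cancel_left, smul_smul]
    rw [← mul_pow]; norm_num

lemma rescale_apply (a y : ι → ℂ) (m : ℕ) : rescale a m y = (2 ^ m : ℂ) • (y - a) := rfl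

lemma rescale_symm_apply (a w : ι → ℂ) (m : ℕ) :
    (rescale a m).symm w = a + ((1 / 2) ^ m : ℂ) • w := rfl

lemma rescale_isAut (a : ι → ℂ) (m : ℕ) : IsAut (rescale a m) := by
  refine ⟨?_, ?_⟩
  · change Differentiable ℂ (fun y : ι → ℂ => (2 ^ m : ℂ) • (y - a))
    fun_prop
  · change Differentiable ℂ (fun w : ι → ℂ => a + ((1 / 2) ^ m : ℂ) • w)
    fun_prop

lemma norm_two_pow (m : ℕ) : ‖(2 ^ m : ℂ)‖ = 2 ^ m := by simp

lemma norm_half_pow (m : ℕ) : ‖((1 / 2) ^ m : ℂ)‖ = (1 / 2) ^ m := by simp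

/-- The construction in `ι → ℂ` with the sup norm. -/
theorem main_pi {i0 i1 : ι} (h01 : i1 ≠ i0) :
    ∃ Ω : ℕ → Set (ι → ℂ), (∀ i, IsOpen (Ω i)) ∧
      (∀ i, ∃ F : (ι → ℂ) → (ι → ℂ), Differentiable ℂ F ∧ Function.Injective F ∧
        Set.range F = Ω i) ∧
      (∀ i l, i ≠ l → Ω i ∩ Ω l = ∅) ∧
      (∀ q ∉ ⋃ i, Ω i, ∀ i, q ∈ closure (Ω i)) := by
  obtain ⟨U, hU⟩ : ∃ U : ℕ → Set (ι → ℂ), TopologicalSpace.IsTopologicalBasis (range U) := by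
    have hb := TopologicalSpace.isBasis_countableBasis (ι → ℂ)
    obtain ⟨v, hv, -⟩ := hb.exists_subset_of_mem_open (mem_univ (0 : ι → ℂ)) isOpen_univ
    obtain ⟨U, hU⟩ := (TopologicalSpace.countable_countableBasis (ι → ℂ)).exists_eq_range ⟨v, hv⟩
    exact ⟨U, hU ▸ hb⟩
  have hstep : ∀ (n : ℕ) (Φ : (ι → ℂ) ≃ (ι → ℂ)), ∃ φ : (ι → ℂ) ≃ (ι → ℂ), IsAut φ ∧
      ((∃ q ∈ U n.unpair.2, ∀ l < n + 1, 1 < ‖Φ q - ctr i0 l‖) →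
        ∃ q ∈ U n.unpair.2, ‖φ (Φ q) - ctr i0 n.unpair.1‖ < 1) ∧
      ∀ l < n + 1,
      (∀ z, ‖z - ctr i0 l‖ ≤ 1 → ‖φ z - (1 / 2 : ℂ) • (z + ctr i0 l)‖ ≤ (1 / 4) ^ n / 8) ∧
      (∀ w, ‖w - ctr i0 l‖ ≤ 1 / 2 →
        ‖φ.symm w - ((2 : ℂ) • w - ctr i0 l)‖ ≤ (1 / 4) ^ n / 8) := by
    intro n Φ
    have hi : n.unpair.1 < n + 1 := Nat.lt_succ_of_le (Nat.unpair_left_le n)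
    by_cases hex : ∃ q ∈ U n.unpair.2, ∀ l < n + 1, 1 < ‖Φ q - ctr i0 l‖
    · obtain ⟨q, hq, hq'⟩ := hex
      obtain ⟨φ, h1, h2, h3⟩ := exists_phi (n + 1) h01 ((1 / 4) ^ n / 8) (by positivity) (Φ q) _ hi
      exact ⟨φ, h1, fun _ => ⟨q, hq, h2 hq'⟩, h3⟩
    · obtain ⟨φ, h1, h2, h3⟩ := exists_phi (n + 1) h01 ((1 / 4) ^ n / 8) (by positivity) 0 _ hi
      exact ⟨φ, h1, fun h => absurd h hex, h3⟩
  choose step st1 st2 st3 using hstep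
  let Φ : ℕ → ((ι → ℂ) ≃ (ι → ℂ)) := fun n =>
    Nat.rec (Equiv.refl _) (fun n Ψ => Ψ.trans (step n Ψ)) n
  have hΦs : ∀ n, Φ (n + 1) = (Φ n).trans (step n (Φ n)) := fun n => rfl
  have hΦa : ∀ n, IsAut (Φ n) := by
    intro n
    induction n with
    | zero => exact IsAut.refl
    | succ n ih => rw [hΦs]; exact ih.trans (st1 _ _)
  have hpers : ∀ l n x, l ≤ n → ‖Φ n x - ctr i0 l‖ ≤ 1 → ‖Φ (n + 1) x - ctr i0 l‖ < 1 := by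
    intro l n x hln hx
    have h1 := (st3 n (Φ n) l (by omega)).1 _ hx
    rw [hΦs, Equiv.trans_apply]
    set y := Φ n x
    have h2 : step n (Φ n) y - ctr i0 l = (step n (Φ n) y - (1 / 2 : ℂ) • (y + ctr i0 l))
        + (1 / 2 : ℂ) • (y - ctr i0 l) := by module
    rw [h2]
    refine (norm_add_le _ _).trans_lt ?_
    have b6 : ‖(1 / 2 : ℂ)‖ = 1 / 2 := by simp
    have b7 : (1 / 4 : ℝ) ^ n ≤ 1 := pow_le_one₀ (by norm_num) (by norm_num)
    rw [norm_smul, b6]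
    linarith
  have hpers' : ∀ l n x, l ≤ n → ‖Φ n x - ctr i0 l‖ < 1 → ∀ j, ‖Φ (n + j) x - ctr i0 l‖ < 1 := by
    intro l n x hln hx j
    induction j with
    | zero => exact hx
    | succ j ih => exact hpers l (n + j) x (by omega) ih.le
  refine ⟨fun l => {x | ∃ m, ‖Φ (l + m) x - ctr i0 l‖ < 1}, ?_, ?_, ?_, ?_⟩
  · intro l
    have : {x | ∃ m, ‖Φ (l + m) x - ctr i0 l‖ < 1} = ⋃ m, {x | ‖Φ (l + m) x - ctr i0 l‖ < 1} := by
      ext x; simp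
    change IsOpen {x | ∃ m, ‖Φ (l + m) x - ctr i0 l‖ < 1}
    rw [this]
    refine isOpen_iUnion fun m => ?_
    have hc := (hΦa (l + m)).1.continuous
    exact isOpen_lt (by fun_prop) continuous_const
  · intro l
    set a := ctr i0 l with ha
    obtain ⟨F, hF1, hF2, hF3⟩ := basin_abstract (fun m => (Φ (l + m)).trans (rescale a m))
      (fun m => ((hΦa _).trans (rescale_isAut a m)).1)
      (fun m => ((hΦa _).trans (rescale_isAut a m)).2) (by
        intro m w hw
        simp only [Equiv.trans_apply, Equiv.symm_trans_apply]
        rw [← add_assoc, hΦs]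
        simp only [Equiv.symm_trans_apply, Equiv.apply_symm_apply]
        set y := (rescale a (m + 1)).symm w with hy
        have hya : y - a = ((1 / 2) ^ (m + 1) : ℂ) • w := by
          rw [hy, rescale_symm_apply, add_sub_cancel_left]
        have h1 := (st3 (l + m) (Φ (l + m)) l (by omega)).2 y (by
          rw [← ha, hya, norm_smul, norm_half_pow]
          calc (1 / 2 : ℝ) ^ (m + 1) * ‖w‖ ≤ (1 / 2 : ℝ) ^ (m + 1) * 2 ^ m := by gcongr
            _ = (1 / 2 * 2) ^ m / 2 := by rw [mul_pow, pow_succ]; ring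
            _ = 1 / 2 := by norm_num)
        rw [← ha] at h1
        set s := (step (l + m) (Φ (l + m))).symm y
        have hw2 : w = (2 ^ m : ℂ) • ((2 : ℂ) • (y - a)) := by
          rw [hya, smul_smul, smul_smul]
          have : (2 ^ m * (2 * (1 / 2) ^ (m + 1)) : ℂ) = 1 := by
            rw [pow_succ, show (2 ^ m * (2 * ((1 / 2) ^ m * (1 / 2))) : ℂ) = (2 * (1 / 2)) ^ m by
              rw [mul_pow]; ring]
            norm_num
          rw [← mul_assoc] at this
          rw [this, one_smul]
        have e : rescale a m s - w = (2 ^ m : ℂ) • (s - ((2 : ℂ) • y - a)) := by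
          rw [rescale_apply]
          nth_rewrite 1 [hw2]
          module
        rw [e, norm_smul, norm_two_pow]
        have p1 : (1 / 4 : ℝ) ^ (l + m) ≤ (1 / 4) ^ m :=
          pow_le_pow_of_le_one (by norm_num) (by norm_num) (by omega)
        calc (2 : ℝ) ^ m * ‖s - ((2 : ℂ) • y - a)‖ ≤ 2 ^ m * ((1 / 4) ^ m / 8) := by
              gcongr; linarith
          _ = (2 * (1 / 4)) ^ m / 8 := by rw [mul_pow]; ring
          _ = (1 / 2) ^ m / 8 := by norm_num
          _ ≤ (1 / 2) ^ m / 4 := by gcongr; norm_num) (by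
        intro m w hw
        simp only [Equiv.trans_apply, Equiv.symm_trans_apply]
        rw [← add_assoc, hΦs]
        simp only [Equiv.trans_apply, Equiv.apply_symm_apply]
        set y := (rescale a m).symm w with hy
        have hya : y - a = ((1 / 2) ^ m : ℂ) • w := by
          rw [hy, rescale_symm_apply, add_sub_cancel_left]
        have h1 := (st3 (l + m) (Φ (l + m)) l (by omega)).1 y (by
          rw [← ha, hya, norm_smul, norm_half_pow]
          calc (1 / 2 : ℝ) ^ m * ‖w‖ ≤ (1 / 2 : ℝ) ^ m * 2 ^ m := by gcongr
            _ = (1 / 2 * 2) ^ m := by rw [mul_pow]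
            _ = 1 := by norm_num
            _ ≤ 1 := le_rfl)
        rw [← ha] at h1
        set s := step (l + m) (Φ (l + m)) y
        have hw2 : w = (2 ^ (m + 1) : ℂ) • ((1 / 2 : ℂ) • (y - a)) := by
          rw [hya, smul_smul, smul_smul]
          have : (2 ^ (m + 1) * (1 / 2 * (1 / 2) ^ m) : ℂ) = 1 := by
            rw [pow_succ, show (2 ^ m * 2 * (1 / 2 * (1 / 2) ^ m) : ℂ) = (2 * (1 / 2)) ^ m by
              rw [mul_pow]; ring]
            norm_num
          rw [← mul_assoc] at this
          rw [this, one_smul]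
        have e : rescale a (m + 1) s - w = (2 ^ (m + 1) : ℂ) • (s - (1 / 2 : ℂ) • (y + a)) := by
          rw [rescale_apply]
          nth_rewrite 1 [hw2]
          module
        rw [e, norm_smul, norm_two_pow]
        have p1 : (1 / 4 : ℝ) ^ (l + m) ≤ (1 / 4) ^ m :=
          pow_le_pow_of_le_one (by norm_num) (by norm_num) (by omega)
        calc (2 : ℝ) ^ (m + 1) * ‖s - (1 / 2 : ℂ) • (y + a)‖
              ≤ 2 ^ (m + 1) * ((1 / 4) ^ m / 8) := by gcongr; linarith
          _ = (2 * (1 / 4)) ^ m / 4 := by rw [mul_pow, pow_succ]; ring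
          _ = (1 / 2) ^ m / 4 := by norm_num
          _ ≤ (1 / 2) ^ m / 4 := le_rfl)
    refine ⟨F, hF1, hF2, ?_⟩
    rw [hF3]
    ext x
    simp only [mem_setOf_eq, Equiv.trans_apply, rescale_apply, norm_smul, norm_two_pow]
    refine exists_congr fun m => ?_
    have : (0 : ℝ) < 2 ^ m := by positivity
    constructor
    · intro h
      by_contra hcon
      push Not at hcon
      nlinarith
    · intro h
      nlinarith
  · intro i l hil
    rw [Set.eq_empty_iff_forall_notMem]
    rintro x ⟨⟨m, hm⟩, ⟨m', hm'⟩⟩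
    have h1 := hpers' i (i + m) x (by omega) hm (l + m')
    have h2 := hpers' l (l + m') x (by omega) hm' (i + m)
    rw [add_comm (l + m')] at h2
    set y := Φ (i + m + (l + m')) x
    have h3 : ‖ctr i0 l - ctr i0 i‖ < 2 := by
      have := norm_sub_le (y - ctr i0 i) (y - ctr i0 l)
      rw [sub_sub_sub_cancel_left] at this
      linarith
    have h4 := coord_le h3.le i0
    rw [ctr_same, ctr_same, ← Complex.ofReal_sub, Complex.norm_real, Real.norm_eq_abs, abs_le] at h4
    rcases lt_or_gt_of_ne hil with h | h
    · have : (i : ℝ) + 1 ≤ l := by exact_mod_cast h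
      linarith [h4.2]
    · have : (l : ℝ) + 1 ≤ i := by exact_mod_cast h
      linarith [h4.1]
  · intro q hq i
    rw [hU.mem_closure_iff]
    rintro _ ⟨j, rfl⟩ hqj
    set n := Nat.pair i j with hn
    have hin : i ≤ n := Nat.left_le_pair i j
    have hun : n.unpair = (i, j) := Nat.unpair_pair i j
    have h2 := st2 n (Φ n)
    rw [hun] at h2
    obtain ⟨q', hq'U, hq'⟩ := h2 ⟨q, hqj, by
      intro l hl
      by_contra hcon
      push Not at hcon
      apply hq
      rw [mem_iUnion]
      refine ⟨l, n + 1 - l, ?_⟩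
      have e : l + (n + 1 - l) = n + 1 := by omega
      rw [e]
      exact hpers l n q (by omega) hcon⟩
    refine ⟨q', hq'U, n + 1 - i, ?_⟩
    have e : i + (n + 1 - i) = n + 1 := by omega
    rw [e, hΦs]
    exact hq'

end Construction

theorem countably_many_disjoint_FB_domains_dense_union (k : ℕ) (hk : 2 ≤ k) :
    ∃ Ω : ℕ → Set (EuclideanSpace ℂ (Fin k)),
      (∀ i, IsFBDomain (Ω i)) ∧
      (∀ i l, i ≠ l → Ω i ∩ Ω l = ∅) ∧
      (∀ q ∉ ⋃ i, Ω i, ∀ i, q ∈ frontier (Ω i)) ∧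
      Dense (⋃ i, Ω i) := by
  have h01 : (⟨1, by omega⟩ : Fin k) ≠ ⟨0, by omega⟩ := by simp
  obtain ⟨Ω, hopen, hF, hdisj, hcl⟩ := main_pi h01
  set L : EuclideanSpace ℂ (Fin k) ≃L[ℂ] (Fin k → ℂ) := EuclideanSpace.equiv (Fin k) ℂ
  have hopen' : ∀ i, IsOpen (L ⁻¹' Ω i) := fun i => (hopen i).preimage L.continuous
  have hdisj' : ∀ i l, i ≠ l → L ⁻¹' Ω i ∩ L ⁻¹' Ω l = ∅ := by
    intro i l hil
    rw [← preimage_inter, hdisj i l hil, preimage_empty]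
  have hcl' : ∀ q ∉ ⋃ i, L ⁻¹' Ω i, ∀ i, q ∈ closure (L ⁻¹' Ω i) := by
    intro q hq i
    have h1 := hcl (L q) (by simpa using hq) i
    have h2 := L.toHomeomorph.preimage_closure (Ω i)
    change q ∈ closure (L.toHomeomorph ⁻¹' Ω i)
    rw [← h2]
    exact h1
  refine ⟨fun i => L ⁻¹' Ω i, fun i => ⟨hopen' i, ?_, ?_⟩, hdisj', ?_, ?_⟩
  · intro huniv
    have huniv2 : L ⁻¹' Ω i = univ := huniv
    obtain ⟨F, -, -, hFr⟩ := hF (i + 1)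
    have h1 : F 0 ∈ Ω (i + 1) := hFr ▸ mem_range_self 0
    have h2 : L.symm (F 0) ∈ L ⁻¹' Ω i ∩ L ⁻¹' Ω (i + 1) :=
      ⟨by rw [huniv2]; exact mem_univ _, by simpa using h1⟩
    rw [hdisj' i (i + 1) (by omega)] at h2
    exact h2
  · obtain ⟨F, hFd, hFi, hFr⟩ := hF i
    refine ⟨fun z => L.symm (F (L z)), ?_, ?_, ?_⟩
    · exact L.symm.differentiable.comp (hFd.comp L.differentiable)
    · exact L.symm.injective.comp (hFi.comp L.injective)
    · ext x
      rw [mem_preimage, ← hFr]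
      constructor
      · rintro ⟨z, rfl⟩
        exact ⟨L z, by simp⟩
      · rintro ⟨z, hz⟩
        exact ⟨L.symm z, by simp [hz]⟩
  · intro q hq i
    rw [frontier, (hopen' i).interior_eq]
    exact ⟨hcl' q hq i, fun h => hq (mem_iUnion.2 ⟨i, h⟩)⟩
  · intro q
    by_cases hq : q ∈ ⋃ i, L ⁻¹' Ω i
    · exact subset_closure hq
    · exact closure_mono (subset_iUnion (fun i => L ⁻¹' Ω i) 0) (hcl' q hq 0)
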